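/- Let A be an n×n complex matrix, u, v ∈ ℂⁿ, let m_A be the minimal polynomial of A, let p_{uv} be the polynomial satisfying p_{uv}(λ) = v* m_A(λ)(λIₙ − A)⁻¹u outside the spectrum of A, and suppose ζ is a root of p_{uv} of multiplicity exactly k ≥ 1 with m_A(ζ) ≠ 0. Then for every ε > 0 small enough that the closed disc of radius ε around ζ contains no eigenvalue of A and no other root of p_{uv}, there exists T > 0 such that for every τ ∈ ℂ with |τ| > T, the matrix A + τ u v* has exactly k eigenvalues, counted with algebraic multiplicity, in the open disc of radius ε around ζ. -/

import Mathlib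

open Matrix Polynomial

/-- The sum of `1 / (z - a)` over a multiset of points off a circle is continuous on the circle, and
its integral counts the points inside. -/
theorem circleIntegral_multiset_sum_inv_sub (c : ℂ) {R : ℝ} (hR : 0 < R) (s : Multiset ℂ)
    (hs : ∀ a ∈ s, ‖a - c‖ ≠ R) :
    ContinuousOn (fun z => (s.map fun a => 1 / (z - a)).sum) (Metric.sphere c R) ∧
    (∮ z in C(c, R), (s.map fun a => 1 / (z - a)).sum) =
      2 * Real.pi * Complex.I * Multiset.card (s.filter fun a => ‖a - c‖ < R) := by
  induction s using Multiset.induction_on with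
  | empty => simp [circleIntegral, continuousOn_const]
  | cons a s ih =>
    obtain ⟨hcont, hint⟩ := ih fun b hb => hs b (Multiset.mem_cons_of_mem hb)
    have ha : ‖a - c‖ ≠ R := hs a (Multiset.mem_cons_self a s)
    have hcont' : ContinuousOn (fun z : ℂ => 1 / (z - a)) (Metric.sphere c R) := by
      refine ContinuousOn.div continuousOn_const (by fun_prop) fun z hz h => ha ?_
      rw [← sub_eq_zero.mp h]
      exact mem_sphere_iff_norm.mp hz
    simp only [Multiset.map_cons, Multiset.sum_cons]
    refine ⟨hcont'.add hcont, ?_⟩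
    rw [circleIntegral.integral_add (hcont'.circleIntegrable hR.le)
      (hcont.circleIntegrable hR.le), hint]
    rcases lt_or_gt_of_ne ha with h | h
    · rw [Multiset.filter_cons_of_pos (p := fun a => ‖a - c‖ < R) s h, Multiset.card_cons]
      simp only [one_div]
      rw [circleIntegral.integral_sub_inv_of_mem_ball (mem_ball_iff_norm.mpr h)]
      push_cast
      ring
    · rw [Multiset.filter_cons_of_neg (p := fun a => ‖a - c‖ < R) s (not_lt.mpr h.le)]
      have hne : ∀ z ∈ Metric.closedBall c R, z - a ≠ 0 := fun z hz h0 => by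
        rw [sub_eq_zero.mp h0, mem_closedBall_iff_norm] at hz
        linarith
      rw [DiffContOnCl.circleIntegral_eq_zero hR.le, zero_add]
      refine DifferentiableOn.diffContOnCl fun z hz => ?_
      rw [closure_ball c hR.ne'] at hz
      exact ((differentiableAt_const 1).div (differentiableAt_id.sub_const a)
        (hne z hz)).differentiableWithinAt

/-- The argument principle for polynomials on a circle. -/
theorem Polynomial.circleIntegral_derivative_div (q : ℂ[X]) (c : ℂ) {R : ℝ} (hR : 0 < R)
    (hq : ∀ z ∈ Metric.sphere c R, q.eval z ≠ 0) :
    (∮ z in C(c, R), q.derivative.eval z / q.eval z) =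
      2 * Real.pi * Complex.I * Multiset.card (q.roots.filter fun a => ‖a - c‖ < R) := by
  rw [← (circleIntegral_multiset_sum_inv_sub c hR q.roots fun a ha h =>
    hq a (mem_sphere_iff_norm.mpr h) (isRoot_of_mem_roots ha)).2]
  exact circleIntegral.integral_congr hR.le fun z hz =>
    (IsAlgClosed.splits q).eval_derivative_div_eval_of_ne_zero (hq z hz)

/-- A small perturbation of a polynomial without zeros on a circle has the same number of zeros
inside the circle. -/
theorem Polynomial.card_roots_filter_sub_C_mul (p m : ℂ[X]) (c : ℂ) {R : ℝ} (hR : 0 < R)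
    (hp : ∀ z ∈ Metric.sphere c R, p.eval z ≠ 0) :
    ∃ η : ℝ, 0 < η ∧ ∀ s : ℂ, ‖s‖ < η →
      Multiset.card ((p - C s * m).roots.filter fun a => ‖a - c‖ < R) =
        Multiset.card (p.roots.filter fun a => ‖a - c‖ < R) := by
  have hK : IsCompact (Metric.sphere c R) := isCompact_sphere c R
  obtain ⟨M, hM⟩ := hK.exists_bound_of_continuousOn (f := fun z => m.eval z / p.eval z)
    (m.continuous.continuousOn.div p.continuous.continuousOn hp)
  set w : ℂ[X] := derivative p * m - derivative m * p with hw
  obtain ⟨L, hL⟩ := hK.exists_bound_of_continuousOn (f := fun z => w.eval z / p.eval z ^ 2)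
    (w.continuous.continuousOn.div (p.continuous.continuousOn.pow 2)
      fun z hz => pow_ne_zero 2 (hp z hz))
  refine ⟨min (1 / (2 * (|M| + 1))) (1 / (4 * R * (|L| + 1))), by positivity, fun s hs => ?_⟩
  have hs1 : ‖s‖ * (2 * (|M| + 1)) < 1 :=
    (lt_div_iff₀ (by positivity)).mp (hs.trans_le (min_le_left _ _))
  have hs2 : ‖s‖ * (4 * R * (|L| + 1)) < 1 :=
    (lt_div_iff₀ (by positivity)).mp (hs.trans_le (min_le_right _ _))
  have hfac : ∀ z ∈ Metric.sphere c R,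
      (p - C s * m).eval z = p.eval z * (1 - s * (m.eval z / p.eval z)) := fun z hz => by
    have := hp z hz
    simp only [eval_sub, eval_mul, eval_C]
    field_simp
  have hhalf : ∀ z ∈ Metric.sphere c R, 1 / 2 ≤ ‖1 - s * (m.eval z / p.eval z)‖ := by
    intro z hz
    have h1 := norm_sub_norm_le (1 : ℂ) (s * (m.eval z / p.eval z))
    rw [norm_one, norm_mul] at h1
    have h2 : ‖s‖ * ‖m.eval z / p.eval z‖ ≤ ‖s‖ * (|M| + 1) :=
      mul_le_mul_of_nonneg_left (by linarith [hM z hz, le_abs_self M]) (norm_nonneg s)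
    linarith
  have hq : ∀ z ∈ Metric.sphere c R, (p - C s * m).eval z ≠ 0 := fun z hz => by
    rw [hfac z hz]
    refine mul_ne_zero (hp z hz) fun h => ?_
    have := hhalf z hz
    rw [h, norm_zero] at this
    norm_num at this
  have hcont : ∀ q : ℂ[X], (∀ z ∈ Metric.sphere c R, q.eval z ≠ 0) →
      CircleIntegrable (fun z => q.derivative.eval z / q.eval z) c R := fun q hq =>
    (q.derivative.continuous.continuousOn.div q.continuous.continuousOn hq).circleIntegrable hR.le
  have hbound : ∀ z ∈ Metric.sphere c R,
      ‖(p - C s * m).derivative.eval z / (p - C s * m).eval z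
        - p.derivative.eval z / p.eval z‖ ≤ 2 * ‖s‖ * (|L| + 1) := fun z hz => by
    have h0 := hp z hz
    have h1 : 1 - s * (m.eval z / p.eval z) ≠ 0 := fun h => hq z hz (by rw [hfac z hz, h, mul_zero])
    have key : (p - C s * m).derivative.eval z / (p - C s * m).eval z
        - p.derivative.eval z / p.eval z =
        s * (w.eval z / p.eval z ^ 2) / (1 - s * (m.eval z / p.eval z)) := by
      rw [div_sub_div _ _ (hq z hz) h0, div_eq_div_iff (mul_ne_zero (hq z hz) h0) h1, hfac z hz]
      simp only [hw, derivative_sub, derivative_mul, derivative_C, eval_sub, eval_mul, eval_C,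
        zero_mul, zero_add]
      field_simp
      ring
    rw [key, norm_div, norm_mul, div_le_iff₀ (norm_pos_iff.mpr h1)]
    calc ‖s‖ * ‖w.eval z / p.eval z ^ 2‖ ≤ ‖s‖ * (|L| + 1) :=
          mul_le_mul_of_nonneg_left (by linarith [hL z hz, le_abs_self L]) (norm_nonneg s)
      _ = 2 * ‖s‖ * (|L| + 1) * (1 / 2) := by ring
      _ ≤ _ := mul_le_mul_of_nonneg_left (hhalf z hz) (by positivity)
  have hnorm := circleIntegral.norm_integral_le_of_norm_le_const hR.le hbound
  rw [circleIntegral.integral_sub (hcont _ hq) (hcont _ hp),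
    circleIntegral_derivative_div _ c hR hq, circleIntegral_derivative_div _ c hR hp,
    ← mul_sub, norm_mul] at hnorm
  set N₁ := Multiset.card ((p - C s * m).roots.filter fun a => ‖a - c‖ < R)
  set N₀ := Multiset.card (p.roots.filter fun a => ‖a - c‖ < R)
  have h2pi : ‖(2 * Real.pi * Complex.I : ℂ)‖ = 2 * Real.pi := by
    simp [abs_of_pos Real.pi_pos]
  have hcast : ‖(N₁ : ℂ) - N₀‖ = |((N₁ : ℤ) - N₀ : ℤ)| := by
    rw [Int.cast_abs, ← Complex.norm_intCast]
    push_cast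
    rfl
  rw [h2pi, hcast, mul_assoc (2 * Real.pi)] at hnorm
  have hle := le_of_mul_le_mul_left hnorm (by positivity)
  have hlt : (|((N₁ : ℤ) - N₀)| : ℤ) < 1 := by
    have : ((|((N₁ : ℤ) - N₀)| : ℤ) : ℝ) < 1 := by
      push_cast at hle ⊢
      nlinarith
    exact_mod_cast this
  have := Int.abs_lt_one_iff.mp hlt
  omega

/-- The characteristic polynomial of a rank-one perturbation, evaluated off the spectrum. -/
theorem Matrix.eval_charpoly_add_smul_vecMulVec {ι K : Type*} [Fintype ι] [DecidableEq ι] [Field K]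
    (A : Matrix ι ι K) (u w : ι → K) (τ z : K) (hz : z ∉ spectrum K A) :
    (A + τ • vecMulVec u w).charpoly.eval z =
      A.charpoly.eval z * (1 - τ * (w ⬝ᵥ (z • (1 : Matrix ι ι K) - A)⁻¹.mulVec u)) := by
  have hB : Matrix.scalar ι z = z • (1 : Matrix ι ι K) := by
    rw [Matrix.scalar_apply, Matrix.smul_one_eq_diagonal]
  have hdet : IsUnit (z • (1 : Matrix ι ι K) - A).det := by
    rw [mem_spectrum_iff_not_isUnit_eval_charpoly, not_not, Matrix.eval_charpoly, hB] at hz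
    exact hz
  rw [Matrix.eval_charpoly, Matrix.eval_charpoly, hB]
  have hsplit : z • (1 : Matrix ι ι K) - (A + τ • vecMulVec u w) =
      (z • (1 : Matrix ι ι K) - A) + replicateCol Unit ((-τ) • u) * replicateRow Unit w := by
    rw [← vecMulVec_eq, smul_vecMulVec, neg_smul]
    abel
  rw [hsplit, det_add_replicateCol_mul_replicateRow hdet, Matrix.mul_assoc,
    ← replicateCol_mulVec, det_unique (n := Unit), Matrix.add_apply, Matrix.one_apply_eq,
    Matrix.replicateRow_mul_replicateCol_apply, mulVec_smul, dotProduct_smul, smul_eq_mul,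
    neg_mul, ← sub_eq_add_neg]

theorem stmt16 {n : ℕ} (A : Matrix (Fin n) (Fin n) ℂ) (u v : Fin n → ℂ)
    (p : Polynomial ℂ)
    (hp : ∀ lam ∉ spectrum ℂ A,
      p.eval lam = (minpoly ℂ A).eval lam *
        (star v ⬝ᵥ (lam • (1 : Matrix (Fin n) (Fin n) ℂ) - A)⁻¹.mulVec u))
    (ζ : ℂ) (k : ℕ) (hk : 1 ≤ k)
    (hmult : p.rootMultiplicity ζ = k)
    (hm : (minpoly ℂ A).eval ζ ≠ 0)
    (ε : ℝ) (hε : 0 < ε)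
    (hεA : ∀ z : ℂ, ‖z - ζ‖ ≤ ε → z ∉ spectrum ℂ A)
    (hεp : ∀ z : ℂ, ‖z - ζ‖ ≤ ε → z ≠ ζ → p.eval z ≠ 0) :
    ∃ T : ℝ, 0 < T ∧ ∀ τ : ℂ, T < ‖τ‖ →
      Multiset.card
        ((A + τ • vecMulVec u (star v)).charpoly.roots.filter fun z => ‖z - ζ‖ < ε) = k := by
  set m := minpoly ℂ A with hmdef
  have hm0 : m ≠ 0 := fun h => hm (by rw [h, eval_zero])
  have hdisc : ∀ q : ℂ[X], q ∣ A.charpoly →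
      q.roots.filter (fun z => ‖z - ζ‖ < ε) = 0 := fun q hq => by
    refine Multiset.filter_eq_nil.mpr fun z hz hlt => hεA z hlt.le ?_
    exact mem_spectrum_of_isRoot_charpoly ((isRoot_of_mem_roots hz).dvd hq)
  have hsphere : ∀ z ∈ Metric.sphere ζ ε, p.eval z ≠ 0 := fun z hz =>
    hεp z (mem_sphere_iff_norm.mp hz).le (Metric.ne_of_mem_sphere hz hε.ne')
  have hcount : Multiset.card (p.roots.filter fun z => ‖z - ζ‖ < ε) = k := by
    rw [← hmult, ← count_roots, Multiset.count_eq_card_filter_eq]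
    congr 1
    refine Multiset.filter_congr fun z hz => ⟨fun hlt => ?_, fun h => by simpa [← h] using hε⟩
    by_contra hne
    exact hεp z hlt.le (Ne.symm hne) (isRoot_of_mem_roots hz)
  obtain ⟨η, hη, hroots⟩ := card_roots_filter_sub_C_mul p m ζ hε hsphere
  refine ⟨η⁻¹, inv_pos.mpr hη, fun τ hτ => ?_⟩
  have hτ0 : τ ≠ 0 := norm_pos_iff.mp ((inv_pos.mpr hη).trans hτ)
  have hτη : ‖τ⁻¹‖ < η := by
    rw [norm_inv]
    exact inv_lt_of_inv_lt₀ hη hτ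
  set χ := (A + τ • vecMulVec u (star v)).charpoly with hχ
  have hmul : χ * m = A.charpoly * (C (-τ) * (p - C τ⁻¹ * m)) := by
    refine eq_of_infinite_eval_eq _ _ (A.finite_spectrum.infinite_compl.mono fun z hz => ?_)
    simp only [Set.mem_ofPred_eq, eval_mul, eval_sub, eval_C]
    rw [hχ, eval_charpoly_add_smul_vecMulVec A u (star v) τ z hz, hp z hz]
    field_simp
    ring
  have hne : χ * m ≠ 0 := mul_ne_zero (charpoly_monic _).ne_zero hm0
  have hfilter := congrArg (fun q : ℂ[X] => q.roots.filter fun z => ‖z - ζ‖ < ε) hmul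
  rw [roots_mul hne, roots_mul (hmul ▸ hne), roots_C_mul _ (neg_ne_zero.mpr hτ0),
    Multiset.filter_add, Multiset.filter_add, hdisc m (minpoly_dvd_charpoly A),
    hdisc _ dvd_rfl, add_zero, zero_add] at hfilter
  rw [hfilter, hroots _ hτη, hcount]
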